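/- Let (R,m) be a local normal domain and let S = R[X_1,...,X_n]_{mR[X_1,...,X_n]} be the polynomial ring over R localized at the extension of m. Then base change along the natural map R → S induces a bijection on isomorphism classes of semidualizing modules: for every semidualizing R-module C, the S-module C ⊗_R S is semidualizing; every semidualizing S-module is isomorphic to C ⊗_R S for some semidualizing R-module C; and if C ⊗_R S ≅ C' ⊗_R S for semidualizing R-modules C, C', then C ≅ C'. -/

import Mathlib

open CategoryTheory

/-- The `i`-th Ext module of two `R`-modules, over a commutative ring `R`. -/
noncomputable def ExtModule (R : Type) [CommRing R] (M N : ModuleCat.{0} R) (i : ℕ) :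
    ModuleCat R :=
  ((Ext R (ModuleCat.{0} R) i).obj (Opposite.op M)).obj N

/-- `C` is a semidualizing `R`-module: it is finitely generated, the homothety map
`R → Hom_R(C,C)` is bijective, and `Ext^i_R(C,C) = 0` for all `i > 0`. -/
def IsSemidualizing (R : Type) [CommRing R] (C : Type) [AddCommGroup C] [Module R C] : Prop :=
  Module.Finite R C ∧
  Function.Bijective (algebraMap R (Module.End R C)) ∧
  ∀ i : ℕ, 0 < i → Subsingleton (ExtModule R (ModuleCat.of R C) (ModuleCat.of R C) i)

/-- `M` has finite injective dimension over `R`: `Ext^i_R(-, M)` vanishes uniformly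
for all large `i`. -/
def HasFiniteInjectiveDimension (R : Type) [CommRing R] (M : Type) [AddCommGroup M]
    [Module R M] : Prop :=
  ∃ n : ℕ, ∀ (N : ModuleCat.{0} R) (i : ℕ), n < i →
    Subsingleton (ExtModule R N (ModuleCat.of R M) i)

/-- A Gorenstein local ring: a commutative Noetherian local ring having finite injective
dimension as a module over itself. -/
def IsGorensteinLocalRing (R : Type) [CommRing R] : Prop :=
  IsNoetherianRing R ∧ IsLocalRing R ∧ HasFiniteInjectiveDimension R R

/-- The length of an `R`-module, i.e. the Krull dimension of its lattice of submodules. -/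
noncomputable def moduleLength (R M : Type) [CommRing R] [AddCommGroup M] [Module R M] :
    WithBot ℕ∞ :=
  Order.krullDim (Submodule R M)

/-- Old-style `Ext` in positive degrees vanishes iff the `Ext` of the derived category does. -/
theorem subsingleton_extModule_iff {R : Type} [CommRing R] (X Y : ModuleCat.{0} R) (p : ℕ) :
    Subsingleton (ExtModule R X Y (p + 1)) ↔ Subsingleton (Abelian.Ext.{0} X Y (p + 1)) := by
  let P : ProjectiveResolution X := ProjectiveResolution.of X
  trans ∀ f : P.complex.X (p + 1) ⟶ Y, P.complex.d (p + 2) (p + 1) ≫ f = 0 →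
      ∃ g : P.complex.X p ⟶ Y, P.complex.d (p + 1) p ≫ g = f
  · rw [ExtModule, (P.isoExt (R := R) (p + 1) Y).toLinearEquiv.toEquiv.subsingleton_congr,
      ← ModuleCat.isZero_iff_subsingleton,
      ← HomologicalComplex.exactAt_iff_isZero_homology,
      HomologicalComplex.exactAt_iff' _ p (p + 1) (p + 2) (by simp) (by simp),
      ShortComplex.moduleCat_exact_iff]
    rfl
  · constructor
    · intro h
      refine subsingleton_of_forall_eq 0 fun α ↦ ?_
      obtain ⟨f, hf, rfl⟩ := P.extMk_surjective α (p + 2) rfl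
      exact (P.extMk_eq_zero_iff f (p + 2) rfl hf p rfl).mpr (h f hf)
    · intro h f hf
      exact (P.extMk_eq_zero_iff f (p + 2) rfl hf p rfl).mp (Subsingleton.elim _ _)

section DimensionShift

variable {R K F M : Type} [CommRing R] [AddCommGroup K] [Module R K] [AddCommGroup F] [Module R F]
  [AddCommGroup M] [Module R M] {ι : K →ₗ[R] F} {π : F →ₗ[R] M}

theorem exists_shortExact_ofHom (hι : Function.Injective ι) (hπ : Function.Surjective π)
    (h : Function.Exact ι π) :
    ∃ w, (ShortComplex.mk (ModuleCat.ofHom ι) (ModuleCat.ofHom π) w).ShortExact :=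
  ⟨by ext x; simpa using h.apply_apply_eq_zero x,
    { exact := (ShortComplex.ShortExact.moduleCat_exact_iff_function_exact _).mpr h
      mono_f := (ModuleCat.mono_iff_injective _).mpr hι
      epi_g := (ModuleCat.epi_iff_surjective _).mpr hπ }⟩

theorem subsingleton_extModule_one_iff [Module.Projective R F] (hι : Function.Injective ι)
    (hπ : Function.Surjective π) (h : Function.Exact ι π)
    (N : Type) [AddCommGroup N] [Module R N] :
    Subsingleton (ExtModule R (ModuleCat.of R M) (ModuleCat.of R N) 1) ↔
      Function.Surjective (LinearMap.lcomp R N ι) := by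
  obtain ⟨w, hS⟩ := exists_shortExact_ofHom hι hπ h
  set S := ShortComplex.mk (ModuleCat.ofHom ι) (ModuleCat.ofHom π) w
  have : Projective S.X₂ := inferInstanceAs (Projective (ModuleCat.of R F))
  rw [subsingleton_extModule_iff]
  constructor
  · intro hs f
    obtain ⟨x, hx⟩ := Abelian.Ext.contravariant_sequence_exact₁ hS (ModuleCat.of R N)
      (Abelian.Ext.mk₀ (ModuleCat.ofHom f)) (n₁ := 1) rfl
      (@Subsingleton.elim _ hs _ _)
    obtain ⟨g, rfl⟩ := Abelian.Ext.addEquiv₀.symm.surjective x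
    rw [Abelian.Ext.addEquiv₀_symm_apply, Abelian.Ext.mk₀_comp_mk₀] at hx
    have hx := Abelian.Ext.addEquiv₀.symm.injective hx
    exact ⟨g.hom, congrArg ModuleCat.Hom.hom hx⟩
  · intro hs
    refine subsingleton_of_forall_eq 0 fun α ↦ ?_
    obtain ⟨x, rfl⟩ := Abelian.Ext.contravariant_sequence_exact₃ hS (ModuleCat.of R N) α
      (Abelian.Ext.eq_zero_of_projective _) (n₀ := 0) rfl
    obtain ⟨g, rfl⟩ := Abelian.Ext.addEquiv₀.symm.surjective x
    obtain ⟨f, hf⟩ := hs g.hom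
    have : g = S.f ≫ ModuleCat.ofHom f := by
      ext x
      exact (LinearMap.congr_fun hf x).symm
    rw [Abelian.Ext.addEquiv₀_symm_apply, this, ← Abelian.Ext.mk₀_comp_mk₀]
    exact hS.extClass_comp_assoc _

theorem subsingleton_extModule_succ_iff [Module.Projective R F] (hι : Function.Injective ι)
    (hπ : Function.Surjective π) (h : Function.Exact ι π)
    (N : Type) [AddCommGroup N] [Module R N] (p : ℕ) :
    Subsingleton (ExtModule R (ModuleCat.of R M) (ModuleCat.of R N) (p + 2)) ↔
      Subsingleton (ExtModule R (ModuleCat.of R K) (ModuleCat.of R N) (p + 1)) := by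
  obtain ⟨w, hS⟩ := exists_shortExact_ofHom hι hπ h
  set S := ShortComplex.mk (ModuleCat.ofHom ι) (ModuleCat.ofHom π) w
  have : Projective S.X₂ := inferInstanceAs (Projective (ModuleCat.of R F))
  rw [subsingleton_extModule_iff, subsingleton_extModule_iff]
  constructor
  · intro hs
    refine subsingleton_of_forall_eq 0 fun α ↦ ?_
    obtain ⟨x, rfl⟩ := Abelian.Ext.contravariant_sequence_exact₁ hS (ModuleCat.of R N)
      α (n₁ := p + 2) (by omega) (@Subsingleton.elim _ hs _ _)
    rw [Abelian.Ext.eq_zero_of_projective x, Abelian.Ext.comp_zero]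
  · intro hs
    refine subsingleton_of_forall_eq 0 fun α ↦ ?_
    obtain ⟨x, rfl⟩ := Abelian.Ext.contravariant_sequence_exact₃ hS (ModuleCat.of R N) α
      (Abelian.Ext.eq_zero_of_projective _) (n₀ := p + 1) (by omega)
    rw [@Subsingleton.elim _ hs x 0, Abelian.Ext.comp_zero]

theorem exists_comp_eq_of_subsingleton_extModule_one (hι : Function.Injective ι)
    (hπ : Function.Surjective π) (h : Function.Exact ι π)
    (N : Type) [AddCommGroup N] [Module R N]
    (hs : Subsingleton (ExtModule R (ModuleCat.of R N) (ModuleCat.of R K) 1)) (f : N →ₗ[R] M) :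
    ∃ g : N →ₗ[R] F, π ∘ₗ g = f := by
  obtain ⟨w, hS⟩ := exists_shortExact_ofHom hι hπ h
  set S := ShortComplex.mk (ModuleCat.ofHom ι) (ModuleCat.ofHom π) w
  rw [subsingleton_extModule_iff] at hs
  obtain ⟨x, hx⟩ := Abelian.Ext.covariant_sequence_exact₃ (ModuleCat.of R N) hS
    (Abelian.Ext.mk₀ (ModuleCat.ofHom f)) (n₁ := 1) rfl (@Subsingleton.elim _ hs _ _)
  obtain ⟨g, rfl⟩ := Abelian.Ext.addEquiv₀.symm.surjective x
  rw [Abelian.Ext.addEquiv₀_symm_apply, Abelian.Ext.mk₀_comp_mk₀] at hx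
  have hx := Abelian.Ext.addEquiv₀.symm.injective hx
  exact ⟨g.hom, congrArg ModuleCat.Hom.hom hx⟩

end DimensionShift

section BaseChange

open TensorProduct

variable {R : Type} [CommRing R]

theorem IsSemidualizing.of_equiv {C C' : Type} [AddCommGroup C] [Module R C] [AddCommGroup C']
    [Module R C'] (e : C ≃ₗ[R] C') (h : IsSemidualizing R C) : IsSemidualizing R C' := by
  obtain ⟨h₁, h₂, h₃⟩ := h
  refine ⟨Module.Finite.equiv e, ?_, fun i hi ↦ ?_⟩
  · have : ⇑(algebraMap R (Module.End R C')) = e.conj ∘ algebraMap R (Module.End R C) := by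
      ext r x
      simp [LinearEquiv.conj_apply]
    rw [this]
    exact e.conj.bijective.comp h₂
  · have i₁ := ((Ext R (ModuleCat.{0} R) i).mapIso e.toModuleIso.symm.op).app (ModuleCat.of R C)
    have i₂ := ((Ext R (ModuleCat.{0} R) i).obj (.op (ModuleCat.of R C'))).mapIso e.toModuleIso
    exact (i₁ ≪≫ i₂).toLinearEquiv.toEquiv.subsingleton_congr.mp (h₃ i hi)

variable {S : Type} [CommRing S] [Algebra R S] [Module.FaithfullyFlat R S]

theorem surjective_lcomp_baseChange_iff {K F N : Type} [AddCommGroup K] [Module R K]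
    [AddCommGroup F] [Module R F] [AddCommGroup N] [Module R N] [Module.FinitePresentation R K]
    [Module.FinitePresentation R F] (ι : K →ₗ[R] F) :
    Function.Surjective (LinearMap.lcomp S (S ⊗[R] N) (ι.baseChange S)) ↔
      Function.Surjective (LinearMap.lcomp R N ι) := by
  let eF := (Module.FinitePresentation.isBaseChange_map R F N S).equiv
  let eK := (Module.FinitePresentation.isBaseChange_map R K N S).equiv
  have comm : LinearMap.lcomp S (S ⊗[R] N) (ι.baseChange S) ∘ₗ eF.toLinearMap =
      eK.toLinearMap ∘ₗ (LinearMap.lcomp R N ι).baseChange S := by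
    ext f k
    simp [eF, eK, IsBaseChange.equiv_tmul]
  rw [← Module.FaithfullyFlat.lTensor_surjective_iff_surjective R S,
    ← EquivLike.surjective_comp eF, ← EquivLike.comp_surjective _ eK]
  exact Eq.to_iff (congrArg Function.Surjective (congrArg DFunLike.coe comm))

theorem subsingleton_extModule_baseChange_iff [IsNoetherianRing R] (N : Type) [AddCommGroup N]
    [Module R N] (p : ℕ) (M : Type) [AddCommGroup M] [Module R M] [Module.Finite R M] :
    Subsingleton (ExtModule S (ModuleCat.of S (S ⊗[R] M)) (ModuleCat.of S (S ⊗[R] N)) (p + 1)) ↔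
      Subsingleton (ExtModule R (ModuleCat.of R M) (ModuleCat.of R N) (p + 1)) := by
  induction p generalizing M with
  | zero =>
    obtain ⟨n, π, hπ⟩ := Module.Finite.exists_fin' R M
    set ι := (LinearMap.ker π).subtype
    have hι : Function.Injective ι := Subtype.val_injective
    have hex : Function.Exact ι π := LinearMap.exact_subtype_ker_map π
    have hι' : Function.Injective (ι.baseChange S) :=
      Module.Flat.lTensor_preserves_injective_linearMap _ hι
    have hπ' : Function.Surjective (π.baseChange S) := LinearMap.lTensor_surjective S hπ
    have hex' : Function.Exact (ι.baseChange S) (π.baseChange S) := lTensor_exact S hex hπ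
    rw [subsingleton_extModule_one_iff hι hπ hex, subsingleton_extModule_one_iff hι' hπ' hex']
    have : Module.FinitePresentation R (LinearMap.ker π) :=
      Module.finitePresentation_of_finite R _
    exact surjective_lcomp_baseChange_iff ι
  | succ p ih =>
    obtain ⟨n, π, hπ⟩ := Module.Finite.exists_fin' R M
    set ι := (LinearMap.ker π).subtype
    have hι : Function.Injective ι := Subtype.val_injective
    have hex : Function.Exact ι π := LinearMap.exact_subtype_ker_map π
    have hι' : Function.Injective (ι.baseChange S) :=
      Module.Flat.lTensor_preserves_injective_linearMap _ hι
    have hπ' : Function.Surjective (π.baseChange S) := LinearMap.lTensor_surjective S hπ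
    have hex' : Function.Exact (ι.baseChange S) (π.baseChange S) := lTensor_exact S hex hπ
    rw [subsingleton_extModule_succ_iff hι hπ hex, subsingleton_extModule_succ_iff hι' hπ' hex']
    exact ih (LinearMap.ker π)

theorem isSemidualizing_baseChange_iff [IsNoetherianRing R] (C : Type) [AddCommGroup C]
    [Module R C] [Module.Finite R C] :
    IsSemidualizing S (S ⊗[R] C) ↔ IsSemidualizing R C := by
  have : Module.FinitePresentation R C := Module.finitePresentation_of_finite R C
  refine and_congr ⟨fun _ ↦ inferInstance, fun _ ↦ inferInstance⟩ (and_congr ?_ ?_)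
  · let eC := (Module.FinitePresentation.isBaseChange_map R C C S).equiv
    have comm : (Algebra.linearMap S (Module.End S (S ⊗[R] C))) ∘ₗ
        (TensorProduct.AlgebraTensorModule.rid R S S).toLinearMap = eC.toLinearMap ∘ₗ
          (Algebra.linearMap R (Module.End R C)).baseChange S := by
      ext
      simp [eC, IsBaseChange.equiv_tmul]
    change _ ↔ Function.Bijective (Algebra.linearMap R (Module.End R C))
    rw [← Module.FaithfullyFlat.lTensor_bijective_iff_bijective R S
        (Algebra.linearMap R (Module.End R C)), ← EquivLike.comp_bijective _ eC]
    refine (EquivLike.bijective_comp (TensorProduct.AlgebraTensorModule.rid R S S) _).symm.trans ?_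
    exact Eq.to_iff (congrArg Function.Bijective (congrArg DFunLike.coe comm))
  · refine forall_congr' fun i ↦ forall_congr' fun hi ↦ ?_
    obtain ⟨p, rfl⟩ := Nat.exists_eq_add_of_lt hi
    simpa using subsingleton_extModule_baseChange_iff C p C

end BaseChange

section Uniqueness

open TensorProduct

/-- If the base changes of `C` and `C'` along a faithfully flat map to a local ring are isomorphic
and only have homotheties as endomorphisms, then `C` and `C'` are isomorphic. -/
theorem nonempty_linearEquiv_of_baseChange {R S : Type} [CommRing R] [IsNoetherianRing R]
    [CommRing S] [IsLocalRing S] [Algebra R S] [Module.FaithfullyFlat R S] {C C' : Type}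
    [AddCommGroup C] [Module R C] [AddCommGroup C'] [Module R C'] [Module.Finite R C]
    (hC : Function.Bijective (algebraMap S (Module.End S (S ⊗[R] C))))
    (φ : S ⊗[R] C ≃ₗ[S] S ⊗[R] C') : Nonempty (C ≃ₗ[R] C') := by
  have : Module.FinitePresentation R C := Module.finitePresentation_of_finite R C
  by_cases! H : ∃ f : C →ₗ[R] C', Function.Bijective f
  · obtain ⟨f, hf⟩ := H
    exact ⟨LinearEquiv.ofBijective f hf⟩
  let eH := (Module.FinitePresentation.isBaseChange_map R C C' S).equiv
  have key (t : S ⊗[R] (C →ₗ[R] C')) :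
      ∃ s ∈ IsLocalRing.maximalIdeal S, eH t = s • φ.toLinearMap := by
    induction t with
    | zero => exact ⟨0, zero_mem _, by simp⟩
    | add x y hx hy =>
      obtain ⟨s, hs, hx⟩ := hx
      obtain ⟨t, ht, hy⟩ := hy
      exact ⟨s + t, add_mem hs ht, by rw [map_add, hx, hy, add_smul]⟩
    | tmul s f =>
      obtain ⟨t, ht⟩ := hC.2 (φ.symm.toLinearMap ∘ₗ f.baseChange S)
      have hf : f.baseChange S = t • φ.toLinearMap := by
        ext x
        have := LinearMap.congr_fun ht (1 ⊗ₜ x)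
        apply φ.symm.injective
        simpa using this.symm
      refine ⟨s * t, Ideal.mul_mem_left _ _ ?_, by
        simp [eH, IsBaseChange.equiv_tmul, hf, mul_smul]⟩
      rw [IsLocalRing.mem_maximalIdeal, mem_nonunits_iff]
      intro hu
      refine H f ((Module.FaithfullyFlat.lTensor_bijective_iff_bijective R S f).mp ?_)
      have h₁ : Function.Bijective (f.baseChange S) := by
        rw [hf]
        convert (φ.trans (LinearEquiv.smulOfUnit hu.unit)).bijective
        ext x
        simp [LinearEquiv.smulOfUnit, Units.smul_def]
      exact h₁
  obtain ⟨s, hs, h⟩ := key (eH.symm φ.toLinearMap)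
  rw [LinearEquiv.apply_symm_apply] at h
  have hu : IsUnit (1 - s) := by
    by_contra hu
    exact (Ideal.ne_top_iff_one _).mp (IsLocalRing.maximalIdeal.isMaximal S).ne_top
      (by simpa using add_mem hs ((IsLocalRing.mem_maximalIdeal _).mpr hu))
  have h0 (x : S ⊗[R] C) : x = 0 := by
    apply φ.injective
    rw [map_zero, ← hu.smul_eq_zero, sub_smul, one_smul, sub_eq_zero]
    exact LinearMap.congr_fun h x
  exact absurd (hC.1 (LinearMap.ext fun x ↦ by rw [h0 x]; simp)) (one_ne_zero (α := S))

end Uniqueness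

section TorsionFree

theorem annihilator_eq_bot_of_injective {R D : Type} [CommRing R] [AddCommGroup D] [Module R D]
    (h : Function.Injective (algebraMap R (Module.End R D))) : Module.annihilator R D = ⊥ := by
  rw [eq_bot_iff]
  intro r hr
  refine h ?_
  ext x
  simpa using Module.mem_annihilator.mp hr x

variable {R : Type} [CommRing R] [IsNoetherianRing R]

/-- A finite module has a nonzero map, killed by the prime `p` containing its annihilator, to any
finite module with an element whose annihilator is `p`. -/
theorem exists_linearMap_ne_zero_of_annihilator_le {M N : Type} [AddCommGroup M] [Module R M]
    [Module.Finite R M] [AddCommGroup N] [Module R N] [Module.Finite R N] (p : Ideal R)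
    [hp : p.IsPrime] (hM : Module.annihilator R M ≤ p) (n : N) (hn : ∀ r : R, r • n = 0 ↔ r ∈ p) :
    ∃ φ : M →ₗ[R] N, φ ≠ 0 ∧ ∀ r ∈ p, r • φ = 0 := by
  have hn0 : n ≠ 0 := by
    rintro rfl
    exact hp.ne_top ((Ideal.eq_top_iff_one _).mpr ((hn 1).mp (by simp)))
  have hns : ¬ Subsingleton ((M ⧸ (p • ⊤ : Submodule R M)) →ₗ[R] N) := by
    rw [IsSMulRegular.subsingleton_linearMap_iff]
    rintro ⟨r, hr, hreg⟩
    have hsupp : (⟨p, hp⟩ : PrimeSpectrum R) ∈ Module.support R (M ⧸ (p • ⊤ : Submodule R M)) := by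
      rw [Module.support_quotient]
      exact ⟨Module.mem_support_iff_of_finite.mpr hM, le_refl p⟩
    have hrp : r ∈ p := Module.mem_support_iff_of_finite.mp hsupp hr
    exact hn0 (hreg (by simpa using (hn r).mpr hrp))
  rw [not_subsingleton_iff_nontrivial] at hns
  obtain ⟨φ, hφ⟩ := exists_ne (0 : (M ⧸ (p • ⊤ : Submodule R M)) →ₗ[R] N)
  refine ⟨φ ∘ₗ Submodule.mkQ _, fun h ↦ hφ ?_, fun r hr ↦ ?_⟩
  · ext x
    exact LinearMap.congr_fun h x
  · ext x
    have : Submodule.Quotient.mk (p := (p • ⊤ : Submodule R M)) (r • x) = 0 :=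
      (Submodule.Quotient.mk_eq_zero _).mpr (Submodule.smul_mem_smul hr trivial)
    simp [← map_smul, ← Submodule.Quotient.mk_smul, this]

theorem exists_isPrime_smul_eq_zero_iff {M : Type} [AddCommGroup M] [Module R M] (x : M)
    (hx : x ≠ 0) :
    ∃ p : Ideal R, p.IsPrime ∧ (∀ r : R, r • x = 0 → r ∈ p) ∧
      ∃ y : M, ∀ r : R, r • y = 0 ↔ r ∈ p := by
  obtain ⟨p, hp, hle⟩ := exists_le_isAssociatedPrime_of_isNoetherianRing R x hx
  obtain ⟨hp, y, rfl⟩ := isAssociatedPrime_iff.mp hp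
  exact ⟨_, hp, fun r hr ↦ hle (by simpa [Submodule.mem_colon_singleton] using hr),
    y, fun r ↦ by simp [Submodule.mem_colon_singleton]⟩

variable [IsDomain R] {D : Type} [AddCommGroup D] [Module R D] [Module.Finite R D]

/-- A finite module over a Noetherian domain all of whose endomorphisms are homotheties is
torsion-free. -/
theorem smul_ne_zero_of_bijective (h : Function.Bijective (algebraMap R (Module.End R D)))
    {s : R} (hs : s ≠ 0) {d : D} (hd : d ≠ 0) : s • d ≠ 0 := by
  intro hsd
  obtain ⟨p, hp, hle, y, hy⟩ := exists_isPrime_smul_eq_zero_iff (R := R) d hd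
  obtain ⟨φ, hφ, hpφ⟩ := exists_linearMap_ne_zero_of_annihilator_le (M := D) p
    (by simp [annihilator_eq_bot_of_injective h.1]) y hy
  obtain ⟨w, rfl⟩ := h.2 φ
  have hw : w ≠ 0 := by
    rintro rfl
    simp at hφ
  refine mul_ne_zero hs hw (h.1 ?_)
  rw [map_mul, map_zero, ← hpφ s (hle s hsd), Algebra.smul_def]

/-- A finite module over a Noetherian domain all of whose endomorphisms are homotheties is
isomorphic to an ideal. -/
theorem exists_injective_of_bijective (h : Function.Bijective (algebraMap R (Module.End R D))) :
    ∃ l : D →ₗ[R] R, Function.Injective l := by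
  obtain ⟨l, hl, -⟩ := exists_linearMap_ne_zero_of_annihilator_le (M := D) (⊥ : Ideal R)
    (annihilator_eq_bot_of_injective h.1).le (1 : R) (by simp)
  obtain ⟨d, hd⟩ := DFunLike.ne_iff.mp hl
  rw [LinearMap.zero_apply] at hd
  have hd0 : d ≠ 0 := by
    rintro rfl
    simp at hd
  obtain ⟨c, hc⟩ := h.2 (l.smulRight d)
  have hc0 : c ≠ 0 := by
    rintro rfl
    have := LinearMap.congr_fun hc d
    exact smul_ne_zero_of_bijective h hd hd0 (by simpa using this.symm)
  refine ⟨l, (injective_iff_map_eq_zero l).mpr fun x hx ↦ ?_⟩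
  by_contra hx0
  refine smul_ne_zero_of_bijective h hc0 hx0 ?_
  simpa [hx] using LinearMap.congr_fun hc x

end TorsionFree

section Divisorial

theorem IsLocalization.exists_dvd_mul_of_algebraMap_dvd {A S : Type} [CommRing A]
    [CommRing S] [Algebra A S] (M : Submonoid A) (hM : M ≤ nonZeroDivisors A)
    [IsLocalization M S] {a b : A} (h : algebraMap A S b ∣ algebraMap A S a) : ∃ m ∈ M, b ∣ m * a := by
  obtain ⟨c, hc⟩ := h
  obtain ⟨⟨c, v⟩, hv⟩ := IsLocalization.surj M c
  refine ⟨v, v.2, c, IsLocalization.injective S hM ?_⟩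
  rw [map_mul, map_mul, hc, ← hv]
  ring

variable {S : Type} [CommRing S] [IsNoetherianRing S] [IsDomain S]

theorem exists_dvd_mul_of_not_dvd [IsIntegrallyClosed S] {p : Ideal S} {x w : S} (hx0 : x ≠ 0)
    (hx : x ∈ p) (hxw : ¬ x ∣ w) (h : ∀ q ∈ p, x ∣ q * w) :
    ∃ q₀ ∈ p, ∃ u ∉ p, ∀ q ∈ p, q₀ ∣ u * q := by
  by_cases! H : ∃ q₀ ∈ p, ∃ u ∉ p, q₀ * w = x * u
  · obtain ⟨q₀, hq₀, u, hu, e⟩ := H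
    refine ⟨q₀, hq₀, u, hu, fun q hq ↦ ?_⟩
    obtain ⟨c, hc⟩ := h q hq
    exact ⟨c, mul_left_cancel₀ hx0 (by linear_combination (-q) * e + q₀ * hc)⟩
  · exfalso
    have hx' : algebraMap S (FractionRing S) x ≠ 0 := by simpa using hx0
    have hint : IsIntegral S (algebraMap S (FractionRing S) w / algebraMap S (FractionRing S) x) := by
      refine isIntegral_of_smul_mem_submodule (A := FractionRing S) (M := FractionRing S)
        (Submodule.map (Algebra.linearMap S (FractionRing S)) p) ?_ ?_ _ ?_
      · rw [Submodule.ne_bot_iff]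
        exact ⟨algebraMap S (FractionRing S) x, ⟨x, hx, rfl⟩, hx'⟩
      · exact (IsNoetherian.noetherian p).map _
      · rintro _ ⟨q, hq, rfl⟩
        obtain ⟨u, hu⟩ := h q hq
        have hup : u ∈ p := by
          by_contra hup
          exact H q hq u hup hu
        refine ⟨u, hup, ?_⟩
        simp only [Algebra.linearMap_apply, smul_eq_mul]
        field_simp
        rw [← map_mul, ← map_mul, mul_comm u, ← hu, mul_comm q]
    obtain ⟨y, hy⟩ := IsIntegrallyClosed.isIntegral_iff.mp hint
    refine hxw ⟨y, IsFractionRing.injective S (FractionRing S) ?_⟩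
    rw [map_mul, hy, mul_div_cancel₀ _ hx']

theorem exists_mem_dvd_mul {p : Ideal S} [hp : p.IsPrime] {q₀ u : S} (hq₀ : q₀ ∈ p) (hu : u ∉ p)
    (h : ∀ q ∈ p, q₀ ∣ u * q) (I : Ideal S) :
    ∃ t ∈ I, ∃ v ∉ p, ∀ i ∈ I, t ∣ v * i := by
  let L := Localization.AtPrime p
  have hunit {s : S} (hs : s ∉ p) : IsUnit (algebraMap S L s) :=
    IsLocalization.map_units L (⟨s, hs⟩ : p.primeCompl)
  have hmax : (IsLocalRing.maximalIdeal L).IsPrincipal := by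
    refine ⟨algebraMap S L q₀, le_antisymm ?_ ?_⟩
    · rw [← IsLocalization.AtPrime.map_eq_maximalIdeal p L, Ideal.map_le_iff_le_comap]
      intro q hq
      obtain ⟨c, hc⟩ := h q hq
      rw [Ideal.mem_comap, ← Ideal.span, Ideal.mem_span_singleton, ← (hunit hu).dvd_mul_left,
        ← map_mul, hc]
      exact map_dvd _ ⟨c, rfl⟩
    · rw [← Ideal.span, Ideal.span_singleton_le_iff_mem,
        ← IsLocalization.AtPrime.map_eq_maximalIdeal p L]
      exact Ideal.mem_map_of_mem _ hq₀
  have : IsNoetherianRing L := IsLocalization.isNoetherianRing p.primeCompl L inferInstance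
  have : IsPrincipalIdealRing L :=
    ((tfae_of_isNoetherianRing_of_isLocalRing_of_isDomain L).out 0 4).mpr hmax
  obtain ⟨τ, hτ⟩ := IsPrincipalIdealRing.principal (I.map (algebraMap S L))
  rw [← Ideal.span] at hτ
  obtain ⟨⟨⟨t, ht⟩, s⟩, e⟩ := (IsLocalization.mem_map_algebraMap_iff p.primeCompl L).mp
    (hτ ▸ Ideal.mem_span_singleton_self τ)
  have key (i : S) (hi : i ∈ I) : ∃ v ∉ p, t ∣ v * i := by
    have h1 : τ ∣ algebraMap S L i := by
      rw [← Ideal.mem_span_singleton, ← hτ]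
      exact Ideal.mem_map_of_mem _ hi
    have h2 : algebraMap S L t ∣ algebraMap S L i := by
      rw [← e, (IsLocalization.map_units L s).mul_right_dvd]
      exact h1
    exact IsLocalization.exists_dvd_mul_of_algebraMap_dvd p.primeCompl
      p.primeCompl_le_nonZeroDivisors h2
  obtain ⟨G, hG⟩ := IsNoetherian.noetherian I
  have key' (F : Finset S) (hF : ∀ i ∈ F, i ∈ I) : ∃ v ∉ p, ∀ i ∈ F, t ∣ v * i := by
    classical
    induction F using Finset.induction_on with
    | empty => exact ⟨1, (Ideal.ne_top_iff_one p).mp hp.ne_top, by simp⟩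
    | insert a F _ ih =>
      obtain ⟨v, hv, h1⟩ := ih fun i hi ↦ hF i (Finset.mem_insert_of_mem hi)
      obtain ⟨v', hv', h2⟩ := key a (hF a (Finset.mem_insert_self _ _))
      refine ⟨v * v', fun hm ↦ (hp.mem_or_mem hm).elim hv hv', fun i hi ↦ ?_⟩
      rcases Finset.mem_insert.mp hi with rfl | hi
      · rw [mul_assoc]
        exact h2.mul_left v
      · rw [mul_comm v, mul_assoc]
        exact (h1 i hi).mul_left v'
  obtain ⟨v, hv, hvG⟩ := key' G fun i hi ↦ hG ▸ Submodule.subset_span hi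
  refine ⟨t, ht, v, hv, fun i hi ↦ ?_⟩
  rw [← hG] at hi
  induction hi using Submodule.span_induction with
  | mem i hi => exact hvG i hi
  | zero => simp
  | add i j _ _ hi hj => simpa [mul_add] using dvd_add hi hj
  | smul r i _ hi => simpa [mul_left_comm] using hi.mul_left r

/-- A nonzero ideal of a normal domain that is semidualizing as a module is divisorial. -/
theorem IsSemidualizing.mem_of_forall_dvd_mul [IsIntegrallyClosed S] {I : Ideal S} (hI : I ≠ ⊥)
    (h : IsSemidualizing S I) (z : S)
    (hz : ∀ a b : S, b ≠ 0 → (∀ i ∈ I, b ∣ a * i) → b ∣ a * z) : z ∈ I := by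
  by_contra hzI
  have hzI' : (⟨I.mkQ z, Submodule.mem_span_singleton_self _⟩ :
      Submodule.span S {I.mkQ z}) ≠ 0 := by
    intro h0
    exact hzI ((Submodule.Quotient.mk_eq_zero _).mp (congrArg Subtype.val h0))
  obtain ⟨p, hp, -, ⟨_, hy⟩, hyp⟩ := exists_isPrime_smul_eq_zero_iff (R := S) _ hzI'
  obtain ⟨s, rfl⟩ := Submodule.mem_span_singleton.mp hy
  replace hyp (r : S) : r * (s * z) ∈ I ↔ r ∈ p := by
    rw [← hyp, Subtype.ext_iff]
    exact (Submodule.Quotient.mk_eq_zero I (x := r • s • z)).symm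
  obtain ⟨x, hx, hx0⟩ := Submodule.exists_mem_ne_zero_of_ne_bot hI
  let ι : I →ₗ[S] I := algebraMap S (Module.End S I) x
  have hι : Function.Injective ι := fun i j hij ↦ Subtype.ext <|
    mul_left_cancel₀ hx0 (congrArg Subtype.val hij)
  obtain ⟨φ, hφ, hpφ⟩ := exists_linearMap_ne_zero_of_annihilator_le (M := I)
    (N := I ⧸ LinearMap.range ι) p (by simp [annihilator_eq_bot_of_injective h.2.1.1])
    (Submodule.Quotient.mk ⟨x * (s * z), I.mul_mem_right _ hx⟩) fun r ↦ by
      rw [← Submodule.Quotient.mk_smul, Submodule.Quotient.mk_eq_zero, ← hyp]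
      constructor
      · rintro ⟨i, hi⟩
        have hi : x * i = r * (x * (s * z)) := congrArg Subtype.val hi
        rw [← mul_left_cancel₀ hx0 (hi.trans (mul_left_comm _ _ _))]
        exact i.2
      · exact fun hr ↦ ⟨⟨_, hr⟩, Subtype.ext (mul_left_comm x r (s * z))⟩
  obtain ⟨g, hg⟩ := exists_comp_eq_of_subsingleton_extModule_one hι
    (Submodule.mkQ_surjective (LinearMap.range ι)) (LinearMap.exact_map_mkQ_range ι) I
    (h.2.2 1 one_pos) φ
  obtain ⟨w, rfl⟩ := h.2.1.2 g
  have hxw : ¬ x ∣ w := by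
    rintro ⟨c, rfl⟩
    refine hφ ?_
    rw [← hg]
    ext i
    refine (Submodule.Quotient.mk_eq_zero _).mpr ⟨c • i, Subtype.ext ?_⟩
    simp [ι]
  have hqw (q : S) (hq : q ∈ p) : x ∣ q * w := by
    have hmem (i : I) : algebraMap S (Module.End S I) (q * w) i ∈ LinearMap.range ι := by
      rw [← Submodule.Quotient.mk_eq_zero, map_mul]
      have := LinearMap.congr_fun (hpφ q hq) i
      rw [← hg] at this
      simpa [smul_comm w q] using this
    obtain ⟨c, hc⟩ := h.2.1.2 ((LinearEquiv.ofInjective ι hι).symm.toLinearMap ∘ₗ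
      LinearMap.codRestrict _ _ hmem)
    have := congrArg (fun i ↦ ((LinearEquiv.ofInjective ι hι i).1 : S))
      (LinearMap.congr_fun hc ⟨x, hx⟩)
    refine ⟨c, mul_right_cancel₀ hx0 ?_⟩
    simpa [ι, mul_assoc] using this.symm
  obtain ⟨q₀, hq₀, u, hu, hq⟩ := exists_dvd_mul_of_not_dvd hx0
    ((hyp x).mp (I.mul_mem_right _ hx)) hxw hqw
  obtain ⟨t, ht, v, hv, hdvd⟩ := exists_mem_dvd_mul hq₀ hu hq I
  have ht0 : t ≠ 0 := by
    rintro rfl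
    have hv0 : v ≠ 0 := fun h0 ↦ hv (h0 ▸ zero_mem p)
    exact mul_ne_zero hv0 hx0 (zero_dvd_iff.mp (hdvd x hx))
  refine hv ((hyp v).mp (I.mem_of_dvd (a := t) ?_ ht))
  rw [← mul_assoc]
  refine hz _ _ ht0 fun i hi ↦ ?_
  rw [mul_assoc, mul_left_comm]
  exact (hdvd i hi).mul_left s

end Divisorial

section Content

variable {σ : Type}

theorem ValuationSubring.exists_map_eq_C_inv_mul {K : Type} [Field K] (V : ValuationSubring K)
    {f : MvPolynomial σ K} (hf : f ≠ 0) :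
    ∃ c : K, c ≠ 0 ∧ ∃ f₁ : MvPolynomial σ V,
      MvPolynomial.map V.subtype f₁ = MvPolynomial.C c⁻¹ * f ∧
      MvPolynomial.map (IsLocalRing.residue V) f₁ ≠ 0 := by
  obtain ⟨a, ha, hmax⟩ := f.support.exists_max_image (fun a ↦ V.valuation (f.coeff a))
    (MvPolynomial.support_nonempty.mpr hf)
  rw [MvPolynomial.mem_support_iff] at ha
  have hV (b) : (f.coeff a)⁻¹ * f.coeff b ∈ V := by
    rw [← V.valuation_le_one_iff, map_mul, map_inv₀,
      inv_mul_le_one₀ (by simpa [zero_lt_iff] using ha)]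
    by_cases hb : b ∈ f.support
    · exact hmax b hb
    · simp [MvPolynomial.notMem_support_iff.mp hb]
  obtain ⟨f₁, hf₁⟩ : MvPolynomial.C (f.coeff a)⁻¹ * f ∈ Set.range (MvPolynomial.map V.subtype) := by
    rw [MvPolynomial.mem_range_map_iff_coeffs_subset]
    intro c hc
    obtain ⟨b, -, rfl⟩ := MvPolynomial.mem_coeffs_iff.mp hc
    rw [MvPolynomial.coeff_C_mul]
    exact ⟨⟨_, hV b⟩, rfl⟩
  refine ⟨_, ha, f₁, hf₁, fun h ↦ ?_⟩
  have h1 : f₁.coeff a = 1 := by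
    apply V.subtype_injective
    rw [← MvPolynomial.coeff_map, hf₁, MvPolynomial.coeff_C_mul, inv_mul_cancel₀ ha, map_one]
  have := congrArg (MvPolynomial.coeff a) h
  rw [MvPolynomial.coeff_map, h1, map_one] at this
  exact one_ne_zero this

theorem ValuationSubring.coeff_mul_coeff_mem {K : Type} [Field K] (V : ValuationSubring K)
    {f g : MvPolynomial σ K} (h : ∀ e, (f * g).coeff e ∈ V) (a b : σ →₀ ℕ) :
    f.coeff a * g.coeff b ∈ V := by
  rcases eq_or_ne f 0 with rfl | hf
  · simp [V.zero_mem]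
  rcases eq_or_ne g 0 with rfl | hg
  · simp [V.zero_mem]
  obtain ⟨c, hc, f₁, hf₁, hf₁'⟩ := V.exists_map_eq_C_inv_mul hf
  obtain ⟨d, hd, g₁, hg₁, hg₁'⟩ := V.exists_map_eq_C_inv_mul hg
  have hmul : MvPolynomial.map (IsLocalRing.residue V) (f₁ * g₁) ≠ 0 := by
    rw [map_mul]
    exact mul_ne_zero hf₁' hg₁'
  obtain ⟨e, he⟩ := MvPolynomial.ne_zero_iff.mp hmul
  rw [MvPolynomial.coeff_map, IsLocalRing.residue_ne_zero_iff_isUnit] at he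
  have hf : f = MvPolynomial.C c * MvPolynomial.map V.subtype f₁ := by
    rw [hf₁, ← mul_assoc, ← map_mul, mul_inv_cancel₀ hc, map_one, one_mul]
  have hg : g = MvPolynomial.C d * MvPolynomial.map V.subtype g₁ := by
    rw [hg₁, ← mul_assoc, ← map_mul, mul_inv_cancel₀ hd, map_one, one_mul]
  have hfg : f * g = MvPolynomial.C (c * d) * MvPolynomial.map V.subtype (f₁ * g₁) := by
    rw [hf, hg, map_mul, map_mul]
    ring
  have hcd : c * d ∈ V := by
    have := h e
    rw [hfg, MvPolynomial.coeff_C_mul, MvPolynomial.coeff_map] at this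
    obtain ⟨u, hu⟩ := he
    rw [← hu] at this
    convert V.mul_mem _ _ this (↑u⁻¹ : V).2 using 1
    rw [mul_assoc]
    simp [← MulMemClass.coe_mul]
  rw [hf, hg, MvPolynomial.coeff_C_mul, MvPolynomial.coeff_C_mul, MvPolynomial.coeff_map,
    MvPolynomial.coeff_map, mul_mul_mul_comm]
  exact V.mul_mem _ _ hcd (V.mul_mem _ _ (f₁.coeff a).2 (g₁.coeff b).2)

/-- The Dedekind–Prague theorem: if `f * g` has coefficients in an integrally closed domain `R`,
then so does every product of a coefficient of `f` with a coefficient of `g`. -/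
theorem coeff_mul_coeff_mem_range {R K : Type} [CommRing R] [IsDomain R] [IsIntegrallyClosed R]
    [Field K] [Algebra R K] [IsFractionRing R K] {f g : MvPolynomial σ K}
    (h : ∀ e, (f * g).coeff e ∈ (algebraMap R K).range) (a b : σ →₀ ℕ) :
    f.coeff a * g.coeff b ∈ (algebraMap R K).range := by
  by_contra hab
  have hbot : (integralClosure R K).toSubring = (algebraMap R K).range := by
    ext x
    exact IsIntegrallyClosed.isIntegral_iff
  have : IsIntegrallyClosedIn (algebraMap R K).range K :=
    hbot ▸ (inferInstance : IsIntegrallyClosedIn (integralClosure R K).toSubring K)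
  obtain ⟨V, hV, hx⟩ := Subring.exists_le_valuationSubring_of_isIntegrallyClosedIn hab
  exact hx (V.coeff_mul_coeff_mem (fun e ↦ hV (h e)) a b)

end Content

section Descent

theorem exists_eq_mul_of_uniqueFactorizationMonoid {ι B : Type} [CommRing B] [IsDomain B]
    [UniqueFactorizationMonoid B] {s : Finset ι} (hs : s.Nonempty) (f : ι → B) :
    ∃ (g : B) (f' : ι → B), (∀ i ∈ s, f i = g * f' i) ∧
      ∀ x y, (∀ i ∈ s, x ∣ y * f' i) → x ∣ y := by
  classical
  let : StrongNormalizationMonoid B := UniqueFactorizationMonoid.strongNormalizationMonoid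
  let : NormalizedGCDMonoid B := UniqueFactorizationMonoid.toNormalizedGCDMonoid B
  obtain ⟨f', hf', h1⟩ := s.extract_gcd f hs
  refine ⟨_, f', hf', fun x y h ↦ ?_⟩
  have := (Finset.dvd_gcd h).trans (Finset.gcd_mul_left' s f' y).dvd
  rwa [h1, mul_one] at this

variable {σ R : Type} [CommRing R] [IsDomain R]

/-- Over the fraction field, finitely many polynomials can be divided by their greatest common
divisor, up to clearing denominators. -/
theorem MvPolynomial.exists_mul_eq_mul {ι : Type} {s : Finset ι} (hs : s.Nonempty)
    (f : ι → MvPolynomial σ R) :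
    ∃ (d g : MvPolynomial σ R) (f' : ι → MvPolynomial σ R), d ≠ 0 ∧
      (∀ i ∈ s, d * f i = g * f' i) ∧ ∀ x y : MvPolynomial σ (FractionRing R),
        (∀ i ∈ s, x ∣ y * map (algebraMap R (FractionRing R)) (f' i)) → x ∣ y := by
  classical
  let := algebraMvPolynomial (σ := σ) (R := R) (S := FractionRing R)
  let M := (nonZeroDivisors R).map (C (σ := σ))
  have hinj : Function.Injective (map (σ := σ) (algebraMap R (FractionRing R))) :=
    map_injective _ (IsFractionRing.injective R _)
  obtain ⟨g, f', hf, hdvd⟩ := exists_eq_mul_of_uniqueFactorizationMonoid hs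
    fun i ↦ map (algebraMap R (FractionRing R)) (f i)
  obtain ⟨b, hb⟩ := IsLocalization.exist_integer_multiples M s f'
  obtain ⟨⟨g', c⟩, hc⟩ := IsLocalization.surj M g
  replace hc : g * map (algebraMap R (FractionRing R)) c =
      map (algebraMap R (FractionRing R)) g' := hc
  choose! f₂ hf₂ using hb
  replace hf₂ (i) (hi : i ∈ s) : map (algebraMap R (FractionRing R)) (f₂ i) =
    map (algebraMap R (FractionRing R)) b * f' i := (hf₂ i hi).trans (Algebra.smul_def _ _)
  have hM (m : M) : (m : MvPolynomial σ R) ≠ 0 := by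
    obtain ⟨_, r, hr, rfl⟩ := m
    simpa using nonZeroDivisors.ne_zero hr
  refine ⟨b * c, g', f₂, mul_ne_zero (hM b) (hM c), fun i hi ↦ hinj ?_,
    fun x y h ↦ hdvd _ _ fun i hi ↦ ?_⟩
  · rw [map_mul, map_mul, map_mul, hf i hi, hf₂ i hi, ← hc]
    ring
  · have hu : IsUnit (map (algebraMap R (FractionRing R)) (b : MvPolynomial σ R)) :=
      IsLocalization.map_units (MvPolynomial σ (FractionRing R)) b
    have := h i hi
    rwa [hf₂ i hi, mul_left_comm, hu.dvd_mul_left] at this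

/-- If the polynomials `f i` are coprime over the fraction field, then every coefficient of one
of them lies in the divisorial closure of the ideal that they generate. -/
theorem MvPolynomial.dvd_mul_C_coeff [IsIntegrallyClosed R] {ι : Type} {s : Finset ι}
    {f : ι → MvPolynomial σ R}
    (hf : ∀ x y : MvPolynomial σ (FractionRing R),
        (∀ i ∈ s, x ∣ y * map (algebraMap R (FractionRing R)) (f i)) → x ∣ y)
    {a b : MvPolynomial σ R} (hb : b ≠ 0) (h : ∀ i ∈ s, b ∣ a * f i) {j : ι} (hj : j ∈ s)
    (e : σ →₀ ℕ) : b ∣ a * C ((f j).coeff e) := by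
  have hinj : Function.Injective (map (σ := σ) (algebraMap R (FractionRing R))) :=
    map_injective _ (IsFractionRing.injective R _)
  have hb' : map (algebraMap R (FractionRing R)) b ≠ 0 := by
    rwa [Ne, ← map_zero (map (algebraMap R (FractionRing R))), hinj.eq_iff]
  obtain ⟨q, hq⟩ := hf (map _ b) (map _ a) fun i hi ↦ by
    rw [← map_mul]
    exact map_dvd _ (h i hi)
  obtain ⟨k, hk⟩ := h j hj
  have hqk : q * map (algebraMap R (FractionRing R)) (f j) =
      map (algebraMap R (FractionRing R)) k := by
    apply mul_left_cancel₀ hb'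
    rw [← map_mul, ← hk, map_mul, hq, mul_assoc]
  have hmem : q * C (algebraMap R (FractionRing R) ((f j).coeff e)) ∈
      Set.range (map (algebraMap R (FractionRing R))) := by
    rw [mem_range_map_iff_coeffs_subset]
    intro c hc
    obtain ⟨m, -, rfl⟩ := mem_coeffs_iff.mp hc
    rw [mul_comm, coeff_C_mul, mul_comm, ← coeff_map]
    exact coeff_mul_coeff_mem_range (fun e ↦ by simp [hqk, coeff_map]) m e
  obtain ⟨q', hq'⟩ := hmem
  refine ⟨q', hinj ?_⟩
  rw [map_mul, map_mul, hq', hq, map_C, mul_assoc]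

end Descent

section Descent

open TensorProduct

/-- A flat base change of an ideal is the extended ideal. -/
theorem Ideal.nonempty_tensorProduct_equiv_map {R S : Type} [CommRing R] [CommRing S] [Algebra R S]
    [Module.Flat R S] (J : Ideal R) : Nonempty (S ⊗[R] J ≃ₗ[S] J.map (algebraMap R S)) := by
  let f : S ⊗[R] J →ₗ[S] S :=
    (AlgebraTensorModule.rid R S S).toLinearMap ∘ₗ J.subtype.baseChange S
  have hf : Function.Injective f := (AlgebraTensorModule.rid R S S).injective.comp
    (Module.Flat.lTensor_preserves_injective_linearMap _ Subtype.val_injective)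
  have hrange : LinearMap.range f = J.map (algebraMap R S) := by
    refine le_antisymm ?_ (Ideal.map_le_iff_le_comap.mpr fun x hx ↦ ⟨1 ⊗ₜ ⟨x, hx⟩, ?_⟩)
    · rintro - ⟨x, rfl⟩
      induction x with
      | zero => simp
      | add x y hx hy => simpa using add_mem hx hy
      | tmul s x =>
        simpa [f, Algebra.smul_def, mul_comm] using
          Ideal.mul_mem_left _ s (Ideal.mem_map_of_mem (algebraMap R S) x.2)
    · simp [f, Algebra.smul_def]
  exact ⟨.ofInjective f hf ≪≫ₗ .ofEq _ _ hrange⟩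

theorem Ideal.nonempty_equiv_of_span_image_mul_eq {S ι : Type} [CommRing S] [IsDomain S]
    {d g : S} (hd : d ≠ 0) (hg : g ≠ 0) {s : Set ι} {f f' : ι → S}
    (h : ∀ i ∈ s, d * f i = g * f' i) :
    Nonempty (Ideal.span (Set.image f s) ≃ₗ[S] Ideal.span (Set.image f' s)) := by
  have hmap : Submodule.map (LinearMap.mulLeft S d) (Ideal.span (Set.image f s)) =
      Submodule.map (LinearMap.mulLeft S g) (Ideal.span (Set.image f' s)) := by
    rw [Ideal.span, Ideal.span, Submodule.map_span, Submodule.map_span, Set.image_image,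
      Set.image_image]
    exact congrArg _ (Set.image_congr h)
  exact ⟨(Submodule.equivMapOfInjective (LinearMap.mulLeft S d) (mul_right_injective₀ hd) _).trans
    ((LinearEquiv.ofEq _ _ hmap).trans
      (Submodule.equivMapOfInjective (LinearMap.mulLeft S g) (mul_right_injective₀ hg) _).symm)⟩

variable {σ R S : Type} [CommRing R] [IsDomain R] [CommRing S] [IsDomain S] [IsNoetherianRing S]
  [Algebra R S] [Algebra (MvPolynomial σ R) S] [IsScalarTower R (MvPolynomial σ R) S]

/-- Up to isomorphism, an ideal of a localization `S` of a polynomial ring over a normal domain `R`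
has an ideal extended from `R` between itself and its divisorial closure. -/
theorem Ideal.exists_equiv_le_map [IsIntegrallyClosed R] (M : Submonoid (MvPolynomial σ R))
    (hM : M ≤ nonZeroDivisors _) [IsLocalization M S] {I : Ideal S} (hI : I ≠ ⊥) :
    ∃ (I₂ : Ideal S) (J : Ideal R), Nonempty (I ≃ₗ[S] I₂) ∧ I₂ ≤ J.map (algebraMap R S) ∧
      ∀ c ∈ J, ∀ a b : S, b ≠ 0 → (∀ i ∈ I₂, b ∣ a * i) → b ∣ a * algebraMap R S c := by
  classical
  have hinj : Function.Injective (algebraMap (MvPolynomial σ R) S) := IsLocalization.injective S hM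
  obtain ⟨T, hT⟩ := IsNoetherian.noetherian I
  have hne : T.Nonempty := by
    rw [Finset.nonempty_iff_ne_empty]
    rintro rfl
    exact hI (by simpa using hT.symm)
  obtain ⟨b, hb⟩ := IsLocalization.exist_integer_multiples_of_finset M T
  choose! f hf using hb
  obtain ⟨d, g, f', hd, hdg, hdvd⟩ := MvPolynomial.exists_mul_eq_mul hne f
  have hmul (t : S) (ht : t ∈ T) : algebraMap _ S (d * b) * t =
      algebraMap _ S g * algebraMap _ S (f' t) := by
    rw [← map_mul, ← hdg t ht, map_mul, map_mul, hf t ht, Algebra.smul_def, mul_assoc]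
  have hdb : algebraMap (MvPolynomial σ R) S (d * b) ≠ 0 := by
    rw [Ne, map_eq_zero_iff _ hinj]
    exact mul_ne_zero hd (nonZeroDivisors.ne_zero (hM b.2))
  have hg : algebraMap (MvPolynomial σ R) S g ≠ 0 := by
    intro hg
    obtain ⟨t, ht, ht0⟩ : ∃ t ∈ T, t ≠ 0 := by
      by_contra! h0
      refine hI ?_
      rw [← hT, Submodule.span_eq_bot]
      exact h0
    have := hmul t ht
    rw [hg, zero_mul] at this
    exact mul_ne_zero hdb ht0 this
  obtain ⟨e⟩ := Ideal.nonempty_equiv_of_span_image_mul_eq (s := (T : Set S)) (f := id)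
    (f' := fun t ↦ algebraMap _ S (f' t)) hdb hg hmul
  refine ⟨_, Ideal.span {c | ∃ t ∈ T, ∃ m, (f' t).coeff m = c},
    ⟨(LinearEquiv.ofEq _ _ (by rw [← hT, Set.image_id])).trans e⟩, ?_, ?_⟩
  · rw [Ideal.span_le]
    rintro - ⟨t, ht, rfl⟩
    rw [IsScalarTower.algebraMap_eq R (MvPolynomial σ R) S, ← Ideal.map_map]
    refine Ideal.mem_map_of_mem _ (MvPolynomial.mem_map_C_iff.mpr fun m ↦ ?_)
    exact Ideal.subset_span ⟨t, ht, m, rfl⟩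
  · intro c hc α β hβ hαβ
    induction hc using Submodule.span_induction with
    | zero => simp
    | add x y _ _ hx hy => simpa [mul_add] using dvd_add hx hy
    | smul r x _ hx => simpa [mul_left_comm] using hx.mul_left (algebraMap R S r)
    | mem c hc =>
      obtain ⟨t₀, ht₀, m, rfl⟩ := hc
      obtain ⟨⟨a₁, u⟩, ha⟩ := IsLocalization.surj M α
      obtain ⟨⟨b₁, v⟩, hb₁⟩ := IsLocalization.surj M β
      have hu := IsLocalization.map_units S u
      have hv := IsLocalization.map_units S v
      dsimp only at ha hb₁
      have hb₁0 : b₁ ≠ 0 := by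
        rintro rfl
        rw [map_zero] at hb₁
        exact mul_ne_zero hβ hv.ne_zero hb₁
      have hiff (x : MvPolynomial σ R) : β ∣ α * algebraMap _ S x ↔
          algebraMap _ S b₁ ∣ algebraMap _ S (a₁ * x) := by
        rw [map_mul, ← ha, ← hb₁, hv.mul_right_dvd, mul_right_comm, hu.dvd_mul_right]
      have key (t : S) (ht : t ∈ T) : ∃ w ∈ M, b₁ ∣ w * (a₁ * f' t) :=
        IsLocalization.exists_dvd_mul_of_algebraMap_dvd M hM
          ((hiff _).mp (hαβ _ (Ideal.subset_span ⟨t, ht, rfl⟩)))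
      choose! w hwM hw using key
      have hprod : ∀ t ∈ T, b₁ ∣ ((∏ t ∈ T, w t) * a₁) * f' t := fun t ht ↦ by
        rw [mul_assoc, ← Finset.mul_prod_erase T w ht, mul_right_comm]
        exact (hw t ht).mul_right _
      have := MvPolynomial.dvd_mul_C_coeff hdvd hb₁0 hprod ht₀ m
      rw [IsScalarTower.algebraMap_apply R (MvPolynomial σ R) S, MvPolynomial.algebraMap_eq, hiff]
      have hW : IsUnit (algebraMap _ S (∏ t ∈ T, w t)) :=
        IsLocalization.map_units S (⟨_, M.prod_mem hwM⟩ : M)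
      rw [← hW.dvd_mul_left, ← map_mul, ← mul_assoc]
      exact map_dvd _ this

/-- Semidualizing modules over a normal localization of a polynomial ring over a normal domain `R`
are extended from `R`. -/
theorem IsSemidualizing.exists_baseChange [IsNoetherianRing R] [IsIntegrallyClosed R]
    [IsIntegrallyClosed S] [Module.FaithfullyFlat R S] (M : Submonoid (MvPolynomial σ R))
    (hM : M ≤ nonZeroDivisors _) [IsLocalization M S] {D : Type} [AddCommGroup D] [Module S D]
    (hD : IsSemidualizing S D) :
    ∃ J : Ideal R, IsSemidualizing R J ∧ Nonempty (D ≃ₗ[S] S ⊗[R] J) := by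
  have : Module.Finite S D := hD.1
  obtain ⟨l, hl⟩ := exists_injective_of_bijective hD.2.1
  let e₁ := LinearEquiv.ofInjective l hl
  have hne : LinearMap.range l ≠ ⊥ := by
    intro h
    have hD0 (x : D) : x = 0 := hl (by simpa [h] using LinearMap.mem_range_self l x)
    exact one_ne_zero (α := S) (hD.2.1.1 (LinearMap.ext fun x ↦ by rw [hD0 x]; simp))
  obtain ⟨I₂, J, ⟨e₂⟩, hle, hJ⟩ := Ideal.exists_equiv_le_map M hM hne
  have hI₂ : IsSemidualizing S I₂ := hD.of_equiv (e₁.trans e₂)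
  have hne₂ : I₂ ≠ ⊥ := by
    rintro rfl
    exact hne ((Submodule.eq_bot_iff _).mpr fun x hx ↦
      congrArg Subtype.val (e₂.injective (Subsingleton.elim (e₂ ⟨x, hx⟩) (e₂ 0))))
  have heq : I₂ = J.map (algebraMap R S) := le_antisymm hle <| Ideal.map_le_iff_le_comap.mpr
    fun c hc ↦ hI₂.mem_of_forall_dvd_mul hne₂ _ (hJ c hc)
  obtain ⟨e₃⟩ := J.nonempty_tensorProduct_equiv_map (S := S)
  let e := (e₁.trans e₂).trans ((LinearEquiv.ofEq _ _ heq).trans e₃.symm)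
  exact ⟨J, (isSemidualizing_baseChange_iff J).mp (hD.of_equiv e), ⟨e⟩⟩

end Descent

section Localization

open MvPolynomial

theorem MvPolynomial.isIntegrallyClosed {σ R : Type} [CommRing R] [IsDomain R]
    [IsIntegrallyClosed R] : IsIntegrallyClosed (MvPolynomial σ R) := by
  let := algebraMvPolynomial (σ := σ) (R := R) (S := FractionRing R)
  have hinj : Function.Injective (algebraMap (MvPolynomial σ R) (MvPolynomial σ (FractionRing R))) :=
    map_injective _ (IsFractionRing.injective R _)
  have : FaithfulSMul (MvPolynomial σ R) (MvPolynomial σ (FractionRing R)) :=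
    (faithfulSMul_iff_algebraMap_injective _ _).mpr hinj
  have : IsIntegrallyClosedIn (MvPolynomial σ R) (MvPolynomial σ (FractionRing R)) := by
    refine isIntegrallyClosedIn_iff.mpr ⟨hinj, fun {p} hp ↦ ?_⟩
    refine mem_range_map_iff_coeffs_subset.mpr fun c hc ↦ ?_
    obtain ⟨m, -, rfl⟩ := mem_coeffs_iff.mp hc
    exact IsIntegrallyClosed.isIntegral_iff.mp (isIntegral_iff_isIntegral_coeff.mp hp m)
  exact .of_isIntegrallyClosed_of_isIntegrallyClosedIn _ (MvPolynomial σ (FractionRing R))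

/-- The localization of a polynomial ring over a local ring at the extension of the maximal
ideal is faithfully flat. -/
theorem MvPolynomial.faithfullyFlat_localization {σ R : Type} [CommRing R] [IsLocalRing R]
    (P : Ideal (MvPolynomial σ R)) [P.IsPrime]
    (hP : P = (IsLocalRing.maximalIdeal R).map (C : R →+* MvPolynomial σ R)) :
    Module.FaithfullyFlat R (Localization.AtPrime P) := by
  have : Module.Flat R (Localization.AtPrime P) :=
    Module.Flat.trans R (MvPolynomial σ R) (Localization.AtPrime P)
  have : IsLocalHom (algebraMap R (Localization.AtPrime P)) := by
    refine ⟨fun r hr ↦ ?_⟩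
    by_contra hr'
    rw [IsScalarTower.algebraMap_apply R (MvPolynomial σ R),
      IsLocalization.AtPrime.isUnit_to_map_iff _ P] at hr
    exact hr (hP ▸ Ideal.mem_map_of_mem _ ((IsLocalRing.mem_maximalIdeal r).mpr hr'))
  exact Module.FaithfullyFlat.of_flat_of_isLocalHom

end Localization

/-- for a local normal domain `(R,m)` and
`S = R[X_1,...,X_n]_{mR[X_1,...,X_n]}`, base change `C ↦ C ⊗_R S` induces a bijection on
isomorphism classes of semidualizing modules. -/
theorem statement14
    (R : Type) [CommRing R] [IsLocalRing R] [IsDomain R] [IsNoetherianRing R]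
    [IsIntegrallyClosed R] (n : ℕ)
    (P : Ideal (MvPolynomial (Fin n) R))
    (hPdef : P = Ideal.map (MvPolynomial.C : R →+* MvPolynomial (Fin n) R)
      (IsLocalRing.maximalIdeal R))
    [P.IsPrime] :
    (∀ (C : Type) [AddCommGroup C] [Module R C], IsSemidualizing R C →
       IsSemidualizing (Localization.AtPrime P)
         (TensorProduct R (Localization.AtPrime P) C)) ∧
    (∀ (D : Type) [AddCommGroup D] [Module (Localization.AtPrime P) D],
       IsSemidualizing (Localization.AtPrime P) D →
       ∃ C : ModuleCat.{0} R, IsSemidualizing R ↥C ∧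
         Nonempty (D ≃ₗ[Localization.AtPrime P]
           TensorProduct R (Localization.AtPrime P) ↥C)) ∧
    (∀ (C C' : Type) [AddCommGroup C] [Module R C] [AddCommGroup C'] [Module R C'],
       IsSemidualizing R C → IsSemidualizing R C' →
       Nonempty ((TensorProduct R (Localization.AtPrime P) C)
         ≃ₗ[Localization.AtPrime P] (TensorProduct R (Localization.AtPrime P) C')) →
       Nonempty (C ≃ₗ[R] C')) := by
  have : Module.FaithfullyFlat R (Localization.AtPrime P) :=
    MvPolynomial.faithfullyFlat_localization P hPdef
  have : IsDomain (Localization.AtPrime P) :=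
    IsLocalization.isDomain_localization P.primeCompl_le_nonZeroDivisors
  have : IsNoetherianRing (Localization.AtPrime P) :=
    IsLocalization.isNoetherianRing P.primeCompl _ inferInstance
  have : IsIntegrallyClosed (MvPolynomial (Fin n) R) := MvPolynomial.isIntegrallyClosed
  have : IsIntegrallyClosed (Localization.AtPrime P) :=
    isIntegrallyClosed_of_isLocalization _ P.primeCompl P.primeCompl_le_nonZeroDivisors
  refine ⟨fun C _ _ hC ↦ ?_, fun D _ _ hD ↦ ?_, fun C C' _ _ _ _ hC hC' ⟨φ⟩ ↦ ?_⟩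
  · have : Module.Finite R C := hC.1
    exact (isSemidualizing_baseChange_iff C).mpr hC
  · obtain ⟨J, hJ, e⟩ := hD.exists_baseChange P.primeCompl P.primeCompl_le_nonZeroDivisors
    exact ⟨ModuleCat.of R J, hJ, e⟩
  · have : Module.Finite R C := hC.1
    exact nonempty_linearEquiv_of_baseChange ((isSemidualizing_baseChange_iff C).mpr hC).2.1 φ
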